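/- For a d-dimensional convex polytope P, g(P) = 1 if and only if P is a simplex. -/

import Mathlib

open Polynomial
open scoped Classical

noncomputable section

/-- `P ⊆ ℝ^d` is a (convex) polytope: the convex hull of a finite set of points. -/
def IsPolytope {d : ℕ} (P : Set (Fin d → ℝ)) : Prop :=
  ∃ S : Finset (Fin d → ℝ), P = convexHull ℝ (S : Set (Fin d → ℝ))

/-- `F` is a face of `P`: the empty set, `P` itself, or the intersection of `P`
with a supporting hyperplane. -/
def IsFace {d : ℕ} (P F : Set (Fin d → ℝ)) : Prop :=
  F = ∅ ∨ F = P ∨ ∃ (f : (Fin d → ℝ) →ₗ[ℝ] ℝ) (c : ℝ),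
    (∀ x ∈ P, f x ≤ c) ∧ F = {x ∈ P | f x = c}

/-- Affine dimension of a subset of `ℝ^d`, with `pdim ∅ = -1`. -/
def pdim {d : ℕ} (P : Set (Fin d → ℝ)) : ℤ :=
  if P = ∅ then -1 else (Module.finrank ℝ (affineSpan ℝ P).direction : ℤ)

/-- The pair of functions `g`, `h` satisfies the defining recursion of the
`g`- and `h`-polynomials of polytopes. -/
def IsGH {d : ℕ} (g h : Set (Fin d → ℝ) → Polynomial ℤ) : Prop :=
  g ∅ = 1 ∧
  (∀ P : Set (Fin d → ℝ), IsPolytope P →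
      h P = ∑ᶠ F ∈ {F : Set (Fin d → ℝ) | IsFace P F ∧ F ≠ P},
        (X - 1 : Polynomial ℤ) ^ (pdim P - pdim F - 1).toNat * g F) ∧
  (∀ P : Set (Fin d → ℝ), IsPolytope P → P ≠ ∅ →
      (g P).coeff 0 = (h P).coeff 0 ∧
      (∀ i : ℕ, 0 < i → 2 * (i : ℤ) ≤ pdim P →
        (g P).coeff i = (h P).coeff i - (h P).coeff (i - 1)) ∧
      (∀ i : ℕ, 0 < i → ¬(2 * (i : ℤ) ≤ pdim P) → (g P).coeff i = 0))

/-- `Q` is (a combinatorial model of) the quotient polytope `P/E`, with `ψ` an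
explicit isomorphism from the interval `[E, P]` in the face poset of `P` to the
face poset of `Q`. -/
def IsQuotientPair {d : ℕ} (P E Q : Set (Fin d → ℝ))
    (ψ : Set (Fin d → ℝ) → Set (Fin d → ℝ)) : Prop :=
  IsPolytope Q ∧
  Set.BijOn ψ {G : Set (Fin d → ℝ) | IsFace P G ∧ E ⊆ G} {G : Set (Fin d → ℝ) | IsFace Q G} ∧
  ∀ G₁ ∈ {G : Set (Fin d → ℝ) | IsFace P G ∧ E ⊆ G},
    ∀ G₂ ∈ {G : Set (Fin d → ℝ) | IsFace P G ∧ E ⊆ G}, (G₁ ⊆ G₂ ↔ ψ G₁ ⊆ ψ G₂)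

/-- The family `gr` of relative `g`-polynomials satisfies the defining relation
`∑_{F ≤ E ≤ P} g(E,F) g(P/E) = g(P)` (where `g(P/P) = 1`, the quotient by `P`
itself being the empty polytope). -/
def IsRelG {d : ℕ} (g : Set (Fin d → ℝ) → Polynomial ℤ)
    (gr : Set (Fin d → ℝ) → Set (Fin d → ℝ) → Polynomial ℤ) : Prop :=
  ∀ (P F : Set (Fin d → ℝ)) (Q : Set (Fin d → ℝ) → Set (Fin d → ℝ))
    (ψ : Set (Fin d → ℝ) → Set (Fin d → ℝ) → Set (Fin d → ℝ)),
    IsPolytope P → IsFace P F →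
    (∀ E, IsFace P E → F ⊆ E → IsQuotientPair P E (Q E) (ψ E)) →
    (∑ᶠ E ∈ {E : Set (Fin d → ℝ) | IsFace P E ∧ F ⊆ E}, gr E F * g (Q E)) = g P

/-- A rational polytope: the convex hull of finitely many points with rational
coordinates. -/
def IsRationalPolytope {d : ℕ} (P : Set (Fin d → ℝ)) : Prop :=
  ∃ S : Finset (Fin d → ℝ), (∀ v ∈ S, ∀ i : Fin d, ∃ q : ℚ, v i = (q : ℝ)) ∧
    P = convexHull ℝ (S : Set (Fin d → ℝ))

namespace GSimplex

open Filter Topology Module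

variable {d : ℕ}

/-- `U` is relatively open with direction space `D`. -/
def RelOpen (U : Set (Fin d → ℝ)) (D : Submodule ℝ (Fin d → ℝ)) : Prop :=
  (∀ x ∈ U, ∀ y ∈ U, y - x ∈ D) ∧ ∀ x ∈ U, ∃ ε > 0, ∀ v ∈ D, ‖v‖ < ε → x + v ∈ U

/-- `C` has Euler characteristic `w`. -/
def HasChi (C : Set (Fin d → ℝ)) (w : ℤ) : Prop :=
  (C = ∅ ∧ w = 0) ∨ (C.Nonempty ∧ IsCompact C ∧ Convex ℝ C ∧ w = 1) ∨
  (C.Nonempty ∧ Bornology.IsBounded C ∧ Convex ℝ C ∧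
    ∃ D : Submodule ℝ (Fin d → ℝ), RelOpen C D ∧ w = (-1) ^ finrank ℝ D)

/-- The one-dimensional Euler integral of `ω` is `w`. -/
def HasJ (ω : ℝ → ℤ) (w : ℤ) : Prop :=
  ∃ j : ℝ →₀ ℤ, (∀ t, ∀ᶠ s in 𝓝[>] t, ω t - ω s = j t) ∧ (j.sum fun _ a => a) = w

lemma HasJ.sum_eq_zero {ι : Type*} (I : Finset ι) (c w : ι → ℤ) (ω : ι → ℝ → ℤ)
    (h : ∀ i ∈ I, HasJ (ω i) (w i)) (h0 : ∀ t, ∑ i ∈ I, c i * ω i t = 0) :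
    ∑ i ∈ I, c i * w i = 0 := by
  have h' : ∀ i, ∃ j : ℝ →₀ ℤ, i ∈ I → (∀ t, ∀ᶠ s in 𝓝[>] t, ω i t - ω i s = j t) ∧
      (j.sum fun _ a => a) = w i := by
    intro i
    by_cases hi : i ∈ I
    · obtain ⟨j, hj⟩ := h i hi
      exact ⟨j, fun _ => hj⟩
    · exact ⟨0, fun h => absurd h hi⟩
  choose j hj using h'
  have h1 : ∑ i ∈ I, c i • j i = 0 := by
    ext t
    have : ∀ᶠ s in 𝓝[>] t, ∀ i ∈ I, ω i t - ω i s = j i t :=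
      (Filter.eventually_all_finset I).2 fun i hi => (hj i hi).1 t
    obtain ⟨s, hs⟩ := this.exists
    have e : ∑ i ∈ I, c i * j i t = 0 := by
      rw [← sub_zero (0:ℤ)]
      nth_rewrite 1 [← h0 t]
      rw [← h0 s, ← Finset.sum_sub_distrib]
      refine Finset.sum_congr rfl fun i hi => ?_
      rw [← hs i hi]; ring
    simpa [Finsupp.finsetSum_apply] using e
  let T : (ℝ →₀ ℤ) →ₗ[ℤ] ℤ := Finsupp.lsum ℤ fun _ => LinearMap.id
  have hT : ∀ f : ℝ →₀ ℤ, T f = f.sum fun _ a => a := fun f => rfl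
  have := congrArg T h1
  rw [map_sum, map_zero] at this
  rw [← this]
  refine Finset.sum_congr rfl fun i hi => ?_
  rw [map_smul, hT, (hj i hi).2]; rfl

lemma HasJ.zero : HasJ (fun _ => 0) 0 := ⟨0, by simp, by simp⟩

lemma HasJ.Icc {a b : ℝ} (hab : a ≤ b) : HasJ (fun t => if t ∈ Set.Icc a b then 1 else 0) 1 := by
  refine ⟨Finsupp.single b 1, fun t => ?_, by simp⟩
  rcases lt_trichotomy t b with h | h | h
  · rcases lt_or_ge t a with h2 | h2
    · filter_upwards [Ioo_mem_nhdsGT h2] with s hs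
      simp [h.ne', not_le.2 h2, not_le.2 hs.2]
    · filter_upwards [Ioo_mem_nhdsGT h] with s hs
      simp [h.ne', h2, h.le, hs.2.le, h2.trans hs.1.le]
  · subst h
    filter_upwards [self_mem_nhdsWithin] with s hs
    simp [hab, not_le.2 (Set.mem_Ioi.1 hs)]
  · filter_upwards [self_mem_nhdsWithin] with s hs
    simp [h.ne, not_le.2 h, not_le.2 (h.trans (Set.mem_Ioi.1 hs))]

lemma HasJ.Ioo {a b : ℝ} (hab : a < b) (c : ℤ) :
    HasJ (fun t => if t ∈ Set.Ioo a b then c else 0) (-c) := by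
  refine ⟨Finsupp.single a (-c), fun t => ?_, Finsupp.sum_single_index rfl⟩
  rcases lt_trichotomy t a with h | h | h
  · filter_upwards [Ioo_mem_nhdsGT h] with s hs
    simp [h.ne', not_lt.2 h.le, not_lt.2 hs.2.le]
  · subst h
    filter_upwards [Ioo_mem_nhdsGT hab] with s hs
    simp [hs.1, hs.2]
  · rcases lt_or_ge t b with h2 | h2
    · filter_upwards [Ioo_mem_nhdsGT h2] with s hs
      simp [h.ne, h, h2, hs.2, h.trans hs.1]
    · filter_upwards [self_mem_nhdsWithin] with s hs
      simp [h.ne, not_lt.2 h2, not_lt.2 (h2.trans (Set.mem_Ioi.1 hs).le)]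

lemma HasJ.point (a : ℝ) (c : ℤ) : HasJ (fun t => if t = a then c else 0) c := by
  refine ⟨Finsupp.single a c, fun t => ?_, by simp⟩
  rcases lt_trichotomy t a with h | h | h
  · filter_upwards [Ioo_mem_nhdsGT h] with s hs
    simp [h.ne, hs.2.ne]
  · subst h
    filter_upwards [self_mem_nhdsWithin] with s hs
    simp [(Set.mem_Ioi.1 hs).ne']
  · filter_upwards [self_mem_nhdsWithin] with s hs
    simp [h.ne', (h.trans (Set.mem_Ioi.1 hs)).ne']

lemma finrank_inf_ker (D : Submodule ℝ (Fin d → ℝ)) (l : (Fin d → ℝ) →ₗ[ℝ] ℝ)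
    {v : Fin d → ℝ} (hv : v ∈ D) (hl : l v ≠ 0) :
    finrank ℝ (D ⊓ LinearMap.ker l : Submodule ℝ (Fin d → ℝ)) + 1 = finrank ℝ D := by
  have h1 := LinearMap.finrank_range_add_finrank_ker (l.domRestrict D)
  have h2 : LinearMap.range (l.domRestrict D) = ⊤ := by
    rw [LinearMap.range_eq_top]
    intro r
    exact ⟨(r / l v) • ⟨v, hv⟩, by simp [hl]⟩
  rw [h2, finrank_top, finrank_self] at h1
  have h3 : finrank ℝ (LinearMap.ker (l.domRestrict D)) =
      finrank ℝ (D ⊓ LinearMap.ker l : Submodule ℝ (Fin d → ℝ)) := by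
    rw [LinearMap.ker_domRestrict]
    rw [← Submodule.map_comap_subtype]
    exact (LinearEquiv.finrank_eq (Submodule.equivMapOfInjective _ D.injective_subtype _))
  omega

lemma RelOpen.slice {U : Set (Fin d → ℝ)} {D : Submodule ℝ (Fin d → ℝ)} (h : RelOpen U D)
    (l : (Fin d → ℝ) →ₗ[ℝ] ℝ) (t : ℝ) :
    RelOpen (U ∩ {x | l x = t}) (D ⊓ LinearMap.ker l) := by
  refine ⟨fun x hx y hy => ⟨h.1 x hx.1 y hy.1, ?_⟩, fun x hx => ?_⟩
  · have h1 : l x = t := hx.2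
    have h2 : l y = t := hy.2
    simp [h1, h2]
  · obtain ⟨ε, he, H⟩ := h.2 x hx.1
    refine ⟨ε, he, fun v hv hve => ⟨H v hv.1 hve, ?_⟩⟩
    have h1 : l x = t := hx.2
    have h2 : l v = 0 := hv.2
    simp [h1, h2]

lemma convex_slice {C : Set (Fin d → ℝ)} (hC : Convex ℝ C) (l : (Fin d → ℝ) →ₗ[ℝ] ℝ) (t : ℝ) :
    Convex ℝ (C ∩ {x | l x = t}) := hC.inter (convex_hyperplane l.isLinear t)

lemma isCompact_slice {C : Set (Fin d → ℝ)} (hC : IsCompact C) (l : (Fin d → ℝ) →ₗ[ℝ] ℝ) (t : ℝ) :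
    IsCompact (C ∩ {x | l x = t}) :=
  hC.inter_right (isClosed_eq l.continuous_of_finiteDimensional continuous_const)

lemma HasChi.slice {C : Set (Fin d → ℝ)} {w : ℤ} (h : HasChi C w) (l : (Fin d → ℝ) →ₗ[ℝ] ℝ) :
    ∃ ω : ℝ → ℤ, (∀ t, HasChi (C ∩ {x | l x = t}) (ω t)) ∧ HasJ ω w := by
  have hcont : Continuous l := l.continuous_of_finiteDimensional
  rcases h with ⟨rfl, rfl⟩ | ⟨hne, hc, hconv, rfl⟩ | ⟨hne, hb, hconv, D, hD, rfl⟩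
  · exact ⟨fun _ => 0, fun t => Or.inl (by simp), HasJ.zero⟩
  · have himc : IsCompact (l '' C) := hc.image hcont
    have himconv : Convex ℝ (l '' C) := hconv.linear_image l
    have him : l '' C = Set.Icc (sInf (l '' C)) (sSup (l '' C)) :=
      eq_Icc_of_connected_compact ⟨hne.image l, himconv.isPreconnected⟩ himc
    set a := sInf (l '' C)
    set b := sSup (l '' C)
    have hab : a ≤ b := by
      have := hne.image l
      rw [him] at this
      exact Set.nonempty_Icc.1 this
    refine ⟨_, fun t => ?_, HasJ.Icc hab⟩
    simp only [← him]
    by_cases ht : t ∈ l '' C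
    · obtain ⟨x, hx, rfl⟩ := ht
      have : l x ∈ l '' C := ⟨x, hx, rfl⟩
      simp only [this, if_true]
      exact Or.inr (Or.inl ⟨⟨x, hx, rfl⟩, isCompact_slice hc l _, convex_slice hconv l _, rfl⟩)
    · simp only [ht, if_false]
      refine Or.inl ⟨?_, rfl⟩
      rw [Set.eq_empty_iff_forall_notMem]
      exact fun x hx => ht ⟨x, hx.1, hx.2⟩
  · by_cases hl : ∀ v ∈ D, l v = 0
    · obtain ⟨p, hp⟩ := hne
      have hall : ∀ x ∈ C, l x = l p := by
        intro x hx
        have := hl _ (hD.1 p hp x hx)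
        rw [map_sub] at this
        linarith
      refine ⟨_, fun t => ?_, HasJ.point (l p) _⟩
      by_cases ht : t = l p
      · subst ht
        have e : C ∩ {x | l x = l p} = C := Set.inter_eq_left.2 hall
        rw [e]
        simp only [if_true]
        exact Or.inr (Or.inr ⟨⟨p, hp⟩, hb, hconv, D, hD, rfl⟩)
      · simp only [ht, if_false]
        refine Or.inl ⟨?_, rfl⟩
        rw [Set.eq_empty_iff_forall_notMem]
        exact fun x hx => ht (hx.2.symm.trans (hall x hx.1))
    · push Not at hl
      obtain ⟨v, hv, hlv⟩ := hl
      have hfr := finrank_inf_ker D l hv hlv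
      have himconv : Convex ℝ (l '' C) := hconv.linear_image l
      have hopen : IsOpen (l '' C) := by
        rw [Metric.isOpen_iff]
        rintro _ ⟨x, hx, rfl⟩
        obtain ⟨ε, he, H⟩ := hD.2 x hx
        have hvn : 0 < ‖v‖ := by
          rw [norm_pos_iff]; rintro rfl; simp at hlv
        have hlp : 0 < |l v| := abs_pos.2 hlv
        refine ⟨ε * |l v| / ‖v‖, by positivity, fun r hr => ?_⟩
        refine ⟨x + ((r - l x) / l v) • v, H _ (D.smul_mem _ hv) ?_, by simp [hlv]⟩
        rw [Metric.mem_ball, Real.dist_eq, lt_div_iff₀ hvn] at hr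
        rw [norm_smul, Real.norm_eq_abs, abs_div, div_mul_eq_mul_div, div_lt_iff₀ hlp]
        exact hr
      have hbim : Bornology.IsBounded (l '' C) := by
        have := (hb.isCompact_closure.image hcont).isBounded
        exact this.subset (Set.image_mono subset_closure)
      have him : l '' C = Set.Ioo (sInf (l '' C)) (sSup (l '' C)) := by
        have hne' := hne.image l
        refine Set.Subset.antisymm (fun x hx => ⟨?_, ?_⟩) ?_
        · refine lt_of_le_of_ne (csInf_le hbim.bddBelow hx) ?_
          rintro rfl
          obtain ⟨ε, he, H⟩ := Metric.isOpen_iff.1 hopen _ hx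
          have : sInf (l '' C) - ε / 2 ∈ l '' C := H (by
            rw [Metric.mem_ball, Real.dist_eq, abs_lt]; constructor <;> linarith)
          have := csInf_le hbim.bddBelow this
          linarith
        · refine lt_of_le_of_ne (le_csSup hbim.bddAbove hx) ?_
          rintro rfl
          obtain ⟨ε, he, H⟩ := Metric.isOpen_iff.1 hopen _ hx
          have : sSup (l '' C) + ε / 2 ∈ l '' C := H (by
            rw [Metric.mem_ball, Real.dist_eq, abs_lt]; constructor <;> linarith)
          have := le_csSup hbim.bddAbove this
          linarith
        · exact IsConnected.Ioo_csInf_csSup_subset ⟨hne', himconv.isPreconnected⟩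
            hbim.bddBelow hbim.bddAbove
      set a := sInf (l '' C)
      set b := sSup (l '' C)
      have hab : a < b := by
        have := hne.image l
        rw [him] at this
        exact Set.nonempty_Ioo.1 this
      have hsign : ((-1 : ℤ)) ^ finrank ℝ D =
          -(-1) ^ finrank ℝ (D ⊓ LinearMap.ker l : Submodule ℝ (Fin d → ℝ)) := by
        rw [← hfr, pow_succ]; ring
      rw [hsign]
      refine ⟨_, fun t => ?_, HasJ.Ioo hab _⟩
      simp only [← him]
      by_cases ht : t ∈ l '' C
      · obtain ⟨x, hx, rfl⟩ := ht
        have : l x ∈ l '' C := ⟨x, hx, rfl⟩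
        simp only [this, if_true]
        exact Or.inr (Or.inr ⟨⟨x, hx, rfl⟩, hb.subset Set.inter_subset_left,
          convex_slice hconv l _, _, hD.slice l _, rfl⟩)
      · simp only [ht, if_false]
        refine Or.inl ⟨?_, rfl⟩
        rw [Set.eq_empty_iff_forall_notMem]
        exact fun x hx => ht ⟨x, hx.1, hx.2⟩

/-- Euler characteristic is linear on indicator functions. -/
lemma euler_aux (k : ℕ) : ∀ (W : Submodule ℝ (Fin d → ℝ)) (p : Fin d → ℝ), finrank ℝ W = k →
    ∀ {ι : Type} (I : Finset ι) (c w : ι → ℤ) (C : ι → Set (Fin d → ℝ)),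
    (∀ i ∈ I, ∀ x ∈ C i, x - p ∈ W) → (∀ i ∈ I, HasChi (C i) (w i)) →
    (∀ x, ∑ i ∈ I, c i * (if x ∈ C i then 1 else 0) = 0) → ∑ i ∈ I, c i * w i = 0 := by
  induction k with
  | zero =>
    intro W p hW ι I c w C hCW hchi hsum
    have hW0 : W = ⊥ := Submodule.finrank_eq_zero.1 hW
    subst hW0
    have hsub : ∀ i ∈ I, ∀ x ∈ C i, x = p := fun i hi x hx =>
      sub_eq_zero.1 ((Submodule.mem_bot ℝ).1 (hCW i hi x hx))
    rw [← hsum p]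
    refine Finset.sum_congr rfl fun i hi => ?_
    congr 1
    have hp : (C i).Nonempty → p ∈ C i := by
      rintro ⟨x, hx⟩
      rw [← hsub i hi x hx]; exact hx
    rcases hchi i hi with ⟨h, h'⟩ | ⟨hne, -, -, h'⟩ | ⟨hne, -, -, D, hD, h'⟩
    · simp [h, h']
    · simp [hp hne, h']
    · have hD0 : D = ⊥ := by
        rw [Submodule.eq_bot_iff]
        intro v hv
        by_contra hv0
        obtain ⟨ε, he, H⟩ := hD.2 p (hp hne)
        have hvn : 0 < ‖v‖ := norm_pos_iff.2 hv0
        have := hsub i hi _ (H ((ε / 2 / ‖v‖) • v) (D.smul_mem _ hv) (by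
          rw [norm_smul, Real.norm_eq_abs, abs_of_pos (by positivity)]
          field_simp
          linarith))
        simp only [add_eq_left, smul_eq_zero, hv0, or_false] at this
        have h2 : 0 < ε / 2 / ‖v‖ := by positivity
        linarith
      subst hD0
      simp [hp hne, h']
  | succ k ih =>
    intro W p hW ι I c w C hCW hchi hsum
    have hWne : W ≠ ⊥ := by
      rintro rfl
      simp at hW
    obtain ⟨v, hv, hv0⟩ := Submodule.exists_mem_ne_zero_of_ne_bot hWne
    obtain ⟨l, hl⟩ : ∃ l : (Fin d → ℝ) →ₗ[ℝ] ℝ, l v = 1 := by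
      obtain ⟨i, hi⟩ := Function.ne_iff.1 hv0
      exact ⟨(v i)⁻¹ • LinearMap.proj i, by simpa using inv_mul_cancel₀ hi⟩
    have hfr := finrank_inf_ker W l hv (by rw [hl]; exact one_ne_zero)
    have hex : ∀ i, ∃ ω : ℝ → ℤ, i ∈ I →
        (∀ t, HasChi (C i ∩ {x | l x = t}) (ω t)) ∧ HasJ ω (w i) := by
      intro i
      by_cases hi : i ∈ I
      · obtain ⟨ω, h⟩ := (hchi i hi).slice l
        exact ⟨ω, fun _ => h⟩
      · exact ⟨0, fun h => absurd h hi⟩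
    choose ω hω using hex
    refine HasJ.sum_eq_zero I c w ω (fun i hi => (hω i hi).2) fun t => ?_
    refine ih (W ⊓ LinearMap.ker l) (p + (t - l p) • v) (by omega) I c (fun i => ω i t)
      (fun i => C i ∩ {x | l x = t}) ?_ (fun i hi => (hω i hi).1 t) ?_
    · intro i hi x hx
      have h1 : l x = t := hx.2
      refine ⟨?_, by simp [h1, hl]⟩
      rw [← sub_sub]
      exact W.sub_mem (hCW i hi x hx.1) (W.smul_mem _ hv)
    · intro x
      by_cases hx : l x = t
      · simpa [hx] using hsum x
      · simp [hx]

theorem euler_lin {ι : Type} (I : Finset ι) (c w : ι → ℤ) (C : ι → Set (Fin d → ℝ))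
    (hchi : ∀ i ∈ I, HasChi (C i) (w i))
    (hsum : ∀ x, ∑ i ∈ I, c i * (if x ∈ C i then 1 else 0) = 0) : ∑ i ∈ I, c i * w i = 0 :=
  euler_aux _ ⊤ 0 rfl I c w C (fun _ _ _ _ => trivial) hchi hsum

end GSimplex

namespace GSimplex

open Filter Topology Module

variable {d : ℕ}

lemma isFace_iff {P F : Set (Fin d → ℝ)} : IsFace P F ↔ IsExposed ℝ P F := by
  constructor
  · rintro (rfl | rfl | ⟨f, c, hf, rfl⟩)
    · exact isExposed_empty
    · exact IsExposed.refl _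
    · rintro ⟨x0, hx0, hfx0⟩
      refine ⟨LinearMap.toContinuousLinearMap f, ?_⟩
      ext x
      constructor
      · rintro ⟨hx, hfx⟩
        exact ⟨hx, fun y hy => by simpa [hfx] using hf y hy⟩
      · rintro ⟨hx, hfx⟩
        have := hfx x0 hx0
        simp only [LinearMap.coe_toContinuousLinearMap'] at this
        exact ⟨hx, le_antisymm (hf x hx) (hfx0 ▸ this)⟩
  · intro h
    rcases F.eq_empty_or_nonempty with rfl | hne
    · exact Or.inl rfl
    · obtain ⟨l, hl⟩ := h hne
      obtain ⟨x0, hx0⟩ := hne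
      rw [hl] at hx0
      refine Or.inr (Or.inr ⟨l.toLinearMap, l x0, fun x hx => hx0.2 x hx, ?_⟩)
      rw [hl]
      ext x
      constructor
      · rintro ⟨hx, h⟩
        exact ⟨hx, le_antisymm (hx0.2 x hx) (h x0 hx0.1)⟩
      · rintro ⟨hx, h⟩
        refine ⟨hx, fun y hy => ?_⟩
        have h' : l x = l x0 := h
        rw [h']
        exact hx0.2 y hy

/-- In finite dimensional space: either a point is a relative interior point, or there is a
supporting functional. -/
lemma interior_or_support {F : Set (Fin d → ℝ)} (hF : Convex ℝ F) {x : Fin d → ℝ} (hx : x ∈ F) :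
    (∃ ε > 0, ∀ v ∈ vectorSpan ℝ F, ‖v‖ < ε → x + v ∈ F) ∨
    ∃ f : (Fin d → ℝ) →ₗ[ℝ] ℝ, (∀ y ∈ F, f y ≤ f x) ∧ ∃ y ∈ F, f y < f x := by
  set D := vectorSpan ℝ F with hDdef
  let A : Set D := {v | x + (v : Fin d → ℝ) ∈ F}
  have h0 : (0 : D) ∈ A := by simpa [A] using hx
  have hA : Convex ℝ A := by
    intro u hu v hv a b ha hb hab
    have := hF hu hv ha hb hab
    change x + ((a • u + b • v : D) : Fin d → ℝ) ∈ F
    convert this using 1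
    have hx' : x = (a + b) • x := by rw [hab, one_smul]
    nth_rewrite 1 [hx']
    simp only [Submodule.coe_add, Submodule.coe_smul]
    module
  have hmem : ∀ y ∈ F, y - x ∈ D := fun y hy => vsub_mem_vectorSpan ℝ hy hx
  have hspan : Submodule.span ℝ A = ⊤ := by
    rw [eq_top_iff]
    rintro ⟨v, hv⟩ -
    have hv' := hv
    rw [hDdef, vectorSpan_eq_span_vsub_set_right ℝ hx] at hv'
    have key : Submodule.span ℝ ((· -ᵥ x) '' F) ≤ (Submodule.span ℝ A).map D.subtype := by
      rw [Submodule.span_le]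
      rintro _ ⟨y, hy, rfl⟩
      refine ⟨⟨y - x, hmem y hy⟩, Submodule.subset_span ?_, rfl⟩
      change x + (y - x) ∈ F
      simpa using hy
    obtain ⟨w, hw, hwv⟩ := key hv'
    have : w = ⟨v, hv⟩ := Subtype.ext hwv
    rwa [← this]
  have haff : affineSpan ℝ A = ⊤ := by
    rw [AffineSubspace.affineSpan_eq_top_iff_vectorSpan_eq_top_of_nonempty ℝ D D ⟨0, h0⟩,
      vectorSpan_eq_span_vsub_set_right ℝ h0]
    simpa using hspan
  have hAint : (interior A).Nonempty := hA.interior_nonempty_iff_affineSpan_eq_top.2 haff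
  by_cases h : (0 : D) ∈ interior A
  · left
    obtain ⟨ε, he, H⟩ := Metric.isOpen_iff.1 isOpen_interior _ h
    refine ⟨ε, he, fun v hv hvn => ?_⟩
    have : (⟨v, hv⟩ : D) ∈ interior A := H (by simpa [Metric.mem_ball] using hvn)
    have h3 : (⟨v, hv⟩ : D) ∈ A := interior_subset this
    exact h3
  · right
    obtain ⟨f, hf0, hf⟩ := geometric_hahn_banach_of_nonempty_interior_point hA h hAint
    obtain ⟨g, hg⟩ := LinearMap.exists_extend f.toLinearMap
    have hg' : ∀ (v : D), g v = f v := fun v => by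
      have := LinearMap.congr_fun hg v
      simpa using this
    have hle : ∀ y ∈ F, g y ≤ g x := by
      intro y hy
      have h1 := hf ⟨y - x, hmem y hy⟩ (by change x + (y - x) ∈ F; simpa using hy)
      rw [← hg', map_zero] at h1
      simp only [map_sub] at h1
      linarith
    refine ⟨g, hle, ?_⟩
    by_contra hcon
    push Not at hcon
    apply hf0
    have : f.toLinearMap = 0 := by
      refine LinearMap.ext_on hspan ?_
      intro v hv
      have h1 := hle _ hv
      have h2 := hcon _ hv
      rw [map_add] at h1 h2
      have : f v = 0 := by rw [← hg']; linarith
      simpa using this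
    ext v
    exact LinearMap.congr_fun this v

section polytope

variable {P : Set (Fin d → ℝ)}

lemma IsPolytope.compact (hP : IsPolytope P) : IsCompact P := by
  obtain ⟨S, rfl⟩ := hP
  exact S.finite_toSet.isCompact_convexHull ℝ

lemma IsPolytope.convex (hP : IsPolytope P) : Convex ℝ P := by
  obtain ⟨S, rfl⟩ := hP
  exact convex_convexHull ℝ _

lemma IsPolytope.finite_ext (hP : IsPolytope P) : (P.extremePoints ℝ).Finite := by
  obtain ⟨S, rfl⟩ := hP
  exact S.finite_toSet.subset extremePoints_convexHull_subset

lemma hull_ext {F : Set (Fin d → ℝ)} (hc : IsCompact F) (hconv : Convex ℝ F)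
    (hfin : (F.extremePoints ℝ).Finite) : convexHull ℝ (F.extremePoints ℝ) = F := by
  have := closure_convexHull_extremePoints hc hconv
  rwa [(hfin.isCompact_convexHull ℝ).isClosed.closure_eq] at this

lemma IsPolytope.hull (hP : IsPolytope P) : convexHull ℝ (P.extremePoints ℝ) = P :=
  hull_ext (IsPolytope.compact hP) (IsPolytope.convex hP) (IsPolytope.finite_ext hP)

lemma face_ext {F : Set (Fin d → ℝ)} (hF : IsExposed ℝ P F) :
    F.extremePoints ℝ = F ∩ P.extremePoints ℝ := hF.isExtreme.extremePoints_eq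

lemma face_hull (hP : IsPolytope P) {F : Set (Fin d → ℝ)} (hF : IsExposed ℝ P F) :
    convexHull ℝ (F ∩ P.extremePoints ℝ) = F := by
  rw [← face_ext hF]
  refine hull_ext (hF.isCompact (IsPolytope.compact hP)) (hF.convex (IsPolytope.convex hP)) ?_
  rw [face_ext hF]
  exact (IsPolytope.finite_ext hP).subset Set.inter_subset_right

lemma face_polytope (hP : IsPolytope P) {F : Set (Fin d → ℝ)} (hF : IsExposed ℝ P F) :
    IsPolytope F := by
  refine ⟨((IsPolytope.finite_ext hP).subset (Set.inter_subset_right (s := F))).toFinset, ?_⟩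
  rw [Set.Finite.coe_toFinset, face_hull hP hF]

lemma faces_finite (hP : IsPolytope P) : {F | IsFace P F}.Finite := by
  refine Set.Finite.of_finite_image (f := fun F => F ∩ P.extremePoints ℝ) ?_ ?_
  · refine (IsPolytope.finite_ext hP).finite_subsets.subset ?_
    rintro _ ⟨F, -, rfl⟩
    exact Set.inter_subset_right
  · intro F hF G hG h
    have h' : F ∩ P.extremePoints ℝ = G ∩ P.extremePoints ℝ := h
    rw [← face_hull hP (isFace_iff.1 hF), ← face_hull hP (isFace_iff.1 hG), h']

lemma face_trans (hP : IsPolytope P) {F G : Set (Fin d → ℝ)} (hF : IsExposed ℝ P F)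
    (hG : IsExposed ℝ F G) : IsExposed ℝ P G := by
  intro hne
  obtain ⟨g, hg⟩ := hG hne
  obtain ⟨x0, hx0⟩ := hne
  have hx0F : x0 ∈ F := hG.subset hx0
  obtain ⟨f, hf⟩ := hF ⟨x0, hx0F⟩
  have hx0' := hx0
  rw [hg] at hx0'
  have hx0F' := hx0F
  rw [hf] at hx0F'
  have hfin := IsPolytope.finite_ext hP
  obtain ⟨K, hK⟩ : ∃ K : ℝ, ∀ v ∈ P.extremePoints ℝ, (g v - g x0) / (f x0 - f v) ≤ K := by
    obtain ⟨K, hK⟩ := (hfin.image fun v => (g v - g x0) / (f x0 - f v)).bddAbove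
    exact ⟨K, fun v hv => hK ⟨v, hv, rfl⟩⟩
  have hineq : ∀ y ∈ P, g y - g x0 ≤ K * (f x0 - f y) := by
    have hconv : Convex ℝ {y | (g + K • f) y ≤ g x0 + K * f x0} :=
      convex_halfSpace_le (g + K • f).toLinearMap.isLinear _
    have hsub : P.extremePoints ℝ ⊆ {y | (g + K • f) y ≤ g x0 + K * f x0} := by
      intro v hv
      change g v + K * f v ≤ g x0 + K * f x0
      have hvP : v ∈ P := hv.1
      have h1 : f v ≤ f x0 := hx0F'.2 v hvP
      rcases h1.lt_or_eq with h1 | h1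
      · have := hK v hv
        rw [div_le_iff₀ (by linarith)] at this
        linarith
      · have : v ∈ F := by
          rw [hf]
          exact ⟨hvP, fun y hy => h1 ▸ hx0F'.2 y hy⟩
        have := hx0'.2 v this
        rw [h1]; linarith
    have := convexHull_min hsub hconv
    rw [IsPolytope.hull hP] at this
    intro y hy
    have h1 : g y + K * f y ≤ g x0 + K * f x0 := this hy
    linarith
  refine ⟨g + (K + 1) • f, ?_⟩
  ext y
  constructor
  · intro hy
    have hy' := hy
    rw [hg] at hy'
    have hyF := hy'.1
    rw [hf] at hyF
    have e1 : g y = g x0 := le_antisymm (hx0'.2 y hy'.1) (hy'.2 x0 hx0F)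
    have e2 : f y = f x0 := le_antisymm (hx0F'.2 y hyF.1) (hyF.2 x0 hx0F'.1)
    refine ⟨hyF.1, fun z hz => ?_⟩
    change g z + (K + 1) * f z ≤ g y + (K + 1) * f y
    rw [e1, e2]
    have h1 := hineq z hz
    have h2 := hx0F'.2 z hz
    linarith
  · rintro ⟨hyP, hy⟩
    have h0 : g x0 + (K + 1) * f x0 ≤ g y + (K + 1) * f y := hy x0 hx0F'.1
    have h1 := hineq y hyP
    have h2 := hx0F'.2 y hyP
    have e2 : f y = f x0 := by linarith
    rw [e2] at h1 h0
    have e1 : g y = g x0 := by linarith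
    rw [hg]
    refine ⟨?_, fun z hz => e1 ▸ hx0'.2 z hz⟩
    rw [hf]
    exact ⟨hyP, fun z hz => e2 ▸ hx0F'.2 z hz⟩

/-- The open cell (relative interior) of a face. -/
def cell (P F : Set (Fin d → ℝ)) : Set (Fin d → ℝ) :=
  {x ∈ F | ∀ G, IsExposed ℝ P G → x ∈ G → F ⊆ G}

lemma cell_seg {F : Set (Fin d → ℝ)} (hF : IsExposed ℝ P F) (hPc : Convex ℝ P)
    {x p : Fin d → ℝ} (hx : x ∈ F) (hp : p ∈ cell P F) {s : ℝ} (hs : 0 < s) (hs1 : s ≤ 1) :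
    (1 - s) • x + s • p ∈ cell P F := by
  rcases hs1.lt_or_eq with h | rfl
  · refine ⟨hF.convex hPc hx hp.1 (by linarith) hs.le (by ring), fun G hG hy => ?_⟩
    refine hp.2 G hG ?_
    exact hG.isExtreme.right_mem_of_mem_openSegment (hF.subset hx) (hF.subset hp.1) hy
      ⟨1 - s, s, by linarith, hs, by ring, rfl⟩
  · simpa using hp

lemma cell_convex {F : Set (Fin d → ℝ)} (hF : IsExposed ℝ P F) (hPc : Convex ℝ P) :
    Convex ℝ (cell P F) := by
  intro x hx y hy a b ha hb hab
  rcases hb.lt_or_eq with h | rfl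
  · have : a = 1 - b := by linarith
    rw [this]
    exact cell_seg hF hPc hx.1 hy h (by linarith)
  · have : a = 1 := by linarith
    subst this
    simpa using hx

lemma cell_nonempty (hP : IsPolytope P) {F : Set (Fin d → ℝ)} (hF : IsExposed ℝ P F)
    (hne : F.Nonempty) : (cell P F).Nonempty := by
  have hfin : (F ∩ P.extremePoints ℝ).Finite :=
    (IsPolytope.finite_ext hP).subset Set.inter_subset_right
  have hhull := face_hull hP hF
  set A := hfin.toFinset with hA
  have hAmem : ∀ a ∈ A, a ∈ F := fun a ha => ((Set.Finite.mem_toFinset hfin).1 ha).1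
  have hAne : A.Nonempty := by
    rw [hA, Set.Finite.toFinset_nonempty]
    rw [← hhull] at hne
    exact convexHull_nonempty_iff.1 hne
  have hn : (0 : ℝ) < A.card := by exact_mod_cast hAne.card_pos
  set x := ∑ a ∈ A, (A.card : ℝ)⁻¹ • a with hx
  have hxF : x ∈ F := (hF.convex (IsPolytope.convex hP)).sum_mem (fun _ _ => by positivity)
    (by rw [Finset.sum_const, nsmul_eq_mul]; field_simp) hAmem
  refine ⟨x, hxF, fun G hG hxG => ?_⟩
  obtain ⟨l, hl⟩ := hG ⟨x, hxG⟩
  rw [hl] at hxG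
  have hsum : ∑ a ∈ A, (l x - l a) = 0 := by
    rw [Finset.sum_sub_distrib, Finset.sum_const, nsmul_eq_mul, hx, map_sum]
    simp only [map_smul, smul_eq_mul]
    rw [← Finset.mul_sum]
    field_simp
    ring
  have hz := (Finset.sum_eq_zero_iff_of_nonneg fun a ha =>
    sub_nonneg.2 (hxG.2 a (hF.subset (hAmem a ha)))).1 hsum
  rw [← hhull]
  refine convexHull_min ?_ (hG.convex (IsPolytope.convex hP))
  intro a ha
  have haA : a ∈ A := (Set.Finite.mem_toFinset hfin).2 ha
  have e : l x = l a := sub_eq_zero.1 (hz a haA)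
  rw [hl]
  exact ⟨hF.subset ha.1, fun y hy => e ▸ hxG.2 y hy⟩

lemma cell_relOpen (hP : IsPolytope P) {F : Set (Fin d → ℝ)} (hF : IsExposed ℝ P F) :
    RelOpen (cell P F) (vectorSpan ℝ F) := by
  refine ⟨fun x hx y hy => vsub_mem_vectorSpan ℝ hy.1 hx.1, fun x hx => ?_⟩
  rcases interior_or_support (hF.convex (IsPolytope.convex hP)) hx.1 with
    ⟨ε, he, H⟩ | ⟨f, hf, y, hy, hlt⟩
  · refine ⟨ε / 2, by positivity, fun v hv hvn => ?_⟩
    refine ⟨H v hv (by linarith), fun G hG hG' => hx.2 G hG ?_⟩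
    have h2 : x + (2 : ℝ) • v ∈ F := H _ (Submodule.smul_mem _ _ hv) (by
      rw [norm_smul, Real.norm_ofNat]; linarith)
    refine hG.isExtreme.left_mem_of_mem_openSegment (hF.subset hx.1) (hF.subset h2) hG' ?_
    exact ⟨1 / 2, 1 / 2, by norm_num, by norm_num, by norm_num, by module⟩
  · exfalso
    have hG : IsExposed ℝ F {z ∈ F | f z = f x} :=
      isFace_iff.1 (Or.inr (Or.inr ⟨f, f x, hf, rfl⟩))
    have := (hx.2 _ (face_trans hP hF hG) ⟨hx.1, rfl⟩ hy).2
    linarith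

lemma cell_hasChi (hP : IsPolytope P) {F : Set (Fin d → ℝ)} (hF : IsExposed ℝ P F)
    (hne : F.Nonempty) : HasChi (cell P F) ((-1) ^ finrank ℝ (vectorSpan ℝ F)) :=
  Or.inr (Or.inr ⟨cell_nonempty hP hF hne,
    (IsPolytope.compact hP).isBounded.subset fun _ hx => hF.subset hx.1,
    cell_convex hF (IsPolytope.convex hP), _, cell_relOpen hP hF, rfl⟩)

/-- The finset of all faces. -/
def fcs (P : Set (Fin d → ℝ)) (hP : IsPolytope P) : Finset (Set (Fin d → ℝ)) :=
  (faces_finite hP).toFinset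

lemma mem_fcs (hP : IsPolytope P) {F : Set (Fin d → ℝ)} : F ∈ fcs P hP ↔ IsExposed ℝ P F := by
  simp [fcs, isFace_iff]

/-- Every point is in exactly one cell. -/
lemma cell_cover (hP : IsPolytope P) (x : Fin d → ℝ) :
    ∑ F ∈ fcs P hP, (if x ∈ cell P F then (1 : ℤ) else 0) = if x ∈ P then 1 else 0 := by
  split_ifs with hx
  · set T := (fcs P hP).filter fun F => x ∈ F
    have hT : T.Nonempty := ⟨P, by simp [T, mem_fcs, hx, IsExposed.refl]⟩
    have hI : IsExposed ℝ P (⋂₀ (T : Set (Set (Fin d → ℝ)))) :=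
      IsExposed.sInter hT fun B hB => (mem_fcs hP).1 (Finset.mem_filter.1 hB).1
    have hxI : x ∈ cell P (⋂₀ (T : Set (Set (Fin d → ℝ)))) := by
      refine ⟨fun B hB => (Finset.mem_filter.1 hB).2, fun G hG hxG => ?_⟩
      exact Set.sInter_subset_of_mem (by simp [T, mem_fcs, hG, hxG])
    rw [Finset.sum_eq_single_of_mem _ ((mem_fcs hP).2 hI)]
    · simp [hxI]
    · intro F hF hne
      rw [if_neg]
      intro hxF
      exact hne (Set.Subset.antisymm (hxF.2 _ hI hxI.1) (hxI.2 _ ((mem_fcs hP).1 hF) hxF.1))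
  · refine Finset.sum_eq_zero fun F hF => if_neg fun h => hx ?_
    exact ((mem_fcs hP).1 hF).subset h.1

/-- Sign of a face. -/
def sgn (F : Set (Fin d → ℝ)) : ℤ := if F = ∅ then -1 else (-1) ^ finrank ℝ (vectorSpan ℝ F)

/-- Euler relation. -/
theorem euler1 (hP : IsPolytope P) (hne : P.Nonempty) : ∑ F ∈ fcs P hP, sgn F = 0 := by
  have key := euler_lin (Finset.insertNone (fcs P hP)) (fun o => o.elim (-1) fun _ => 1)
    (fun o => o.elim 1 fun F => if F = ∅ then 0 else (-1) ^ finrank ℝ (vectorSpan ℝ F))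
    (fun o => o.elim P fun F => cell P F) ?_ ?_
  · rw [Finset.sum_insertNone] at key
    simp only [Option.elim] at key
    have h0 : (∅ : Set (Fin d → ℝ)) ∈ fcs P hP := (mem_fcs hP).2 isExposed_empty
    rw [← Finset.add_sum_erase _ _ h0] at key ⊢
    have : ∑ F ∈ (fcs P hP).erase ∅, sgn F = ∑ F ∈ (fcs P hP).erase ∅,
        1 * (if F = ∅ then 0 else (-1 : ℤ) ^ finrank ℝ (vectorSpan ℝ F)) := by
      refine Finset.sum_congr rfl fun F hF => ?_
      simp [sgn, (Finset.mem_erase.1 hF).1]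
    rw [this]
    simp only [sgn, if_true] at key ⊢
    linarith
  · intro o ho
    cases o with
    | none => exact Or.inr (Or.inl ⟨hne, IsPolytope.compact hP, IsPolytope.convex hP, rfl⟩)
    | some F =>
      have hF := (mem_fcs hP).1 (Finset.some_mem_insertNone.1 ho)
      rcases F.eq_empty_or_nonempty with rfl | hFne
      · exact Or.inl ⟨by simp [cell], by simp⟩
      · simpa [hFne.ne_empty] using cell_hasChi hP hF hFne
  · intro x
    rw [Finset.sum_insertNone]
    refine Eq.trans (b := (-1) * (if x ∈ P then (1 : ℤ) else 0) +
      ∑ F ∈ fcs P hP, if x ∈ cell P F then (1 : ℤ) else 0) ?_ (by rw [cell_cover]; ring)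
    exact congrArg₂ _ rfl (Finset.sum_congr rfl fun F _ => one_mul _)

end polytope

end GSimplex

namespace GSimplex

open Filter Topology Module

variable {d : ℕ}

section vertex

variable {P : Set (Fin d → ℝ)}

lemma vertex_sep (hP : IsPolytope P) {v : Fin d → ℝ} (hv : v ∈ P.extremePoints ℝ) :
    ∃ (l : (Fin d → ℝ) →ₗ[ℝ] ℝ) (u : ℝ),
      (∀ a ∈ convexHull ℝ (P.extremePoints ℝ \ {v}), l a < u) ∧ u < l v := by
  have hPc := IsPolytope.convex hP
  have h1 : Convex ℝ (P \ {v}) := (hPc.mem_extremePoints_iff_convex_sdiff.1 hv).2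
  have h2 : v ∉ convexHull ℝ (P.extremePoints ℝ \ {v}) := by
    intro h
    have := convexHull_min (s := P.extremePoints ℝ \ {v})
      (Set.sdiff_subset_sdiff_left extremePoints_subset) h1 h
    exact this.2 rfl
  have hfin : (P.extremePoints ℝ \ {v}).Finite := (IsPolytope.finite_ext hP).sdiff
  obtain ⟨f, u, h3, h4⟩ := geometric_hahn_banach_closed_point (convex_convexHull ℝ _)
    (hfin.isCompact_convexHull ℝ).isClosed h2
  exact ⟨f.toLinearMap, u, h3, h4⟩

lemma eq_singleton_of_ext {F : Set (Fin d → ℝ)} (hP : IsPolytope P) (hF : IsExposed ℝ P F)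
    {v : Fin d → ℝ} (hv : v ∈ F) (h : ∀ e ∈ F ∩ P.extremePoints ℝ, e = v) : F = {v} := by
  refine Set.Subset.antisymm ?_ (Set.singleton_subset_iff.2 hv)
  rw [← face_hull hP hF]
  exact convexHull_min h (convex_singleton v)

lemma vertex_exposed (hP : IsPolytope P) {v : Fin d → ℝ} (hv : v ∈ P.extremePoints ℝ) :
    IsExposed ℝ P {v} := by
  obtain ⟨l, u, h1, h2⟩ := vertex_sep hP hv
  have hext : ∀ e ∈ P.extremePoints ℝ, e ≠ v → l e < l v := fun e he hne =>
    (h1 e (subset_convexHull ℝ _ ⟨he, hne⟩)).trans h2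
  have hle : ∀ x ∈ P, l x ≤ l v := by
    have : P.extremePoints ℝ ⊆ {x | l x ≤ l v} := by
      intro e he
      by_cases h : e = v
      · rw [h]; exact le_refl (l v)
      · exact (hext e he h).le
    have := convexHull_min this (convex_halfSpace_le l.isLinear _)
    rwa [IsPolytope.hull hP] at this
  have hG : IsExposed ℝ P {x ∈ P | l x = l v} :=
    isFace_iff.1 (Or.inr (Or.inr ⟨l, l v, hle, rfl⟩))
  have := eq_singleton_of_ext hP hG (v := v) ⟨hv.1, rfl⟩ (by
    rintro e ⟨⟨_, he⟩, he'⟩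
    by_contra hne
    exact (hext e he' hne).ne he)
  rwa [this] at hG

lemma cell_slice_nonempty (hP : IsPolytope P) {F : Set (Fin d → ℝ)} (hF : IsExposed ℝ P F)
    (l : (Fin d → ℝ) →ₗ[ℝ] ℝ) {u : ℝ} {v e : Fin d → ℝ} (hv : v ∈ F) (he : e ∈ F)
    (h1 : l e < u) (h2 : u < l v) : (cell P F ∩ {x | l x = u}).Nonempty := by
  obtain ⟨p, hp⟩ := cell_nonempty hP hF ⟨v, hv⟩
  have hPc := IsPolytope.convex hP
  rcases le_or_gt (l p) u with h | h
  · have h3 : 0 < l v - l p := by linarith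
    refine ⟨_, cell_seg hF hPc hv hp (s := (l v - u) / (l v - l p)) ?_ ?_, ?_⟩
    · exact div_pos (by linarith) h3
    · rw [div_le_one h3]; linarith
    · change l _ = u
      simp only [map_add, map_smul, smul_eq_mul]
      field_simp
      ring
  · have h3 : 0 < l p - l e := by linarith
    refine ⟨_, cell_seg hF hPc he hp (s := (u - l e) / (l p - l e)) ?_ ?_, ?_⟩
    · exact div_pos (by linarith) h3
    · rw [div_le_one h3]; linarith
    · change l _ = u
      simp only [map_add, map_smul, smul_eq_mul]
      field_simp
      ring

lemma sgn_singleton (v : Fin d → ℝ) : sgn ({v} : Set (Fin d → ℝ)) = 1 := by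
  rw [sgn, if_neg (Set.singleton_ne_empty v), vectorSpan_singleton, finrank_bot, pow_zero]

/-- Euler relation for vertex figures. -/
theorem euler2 (hP : IsPolytope P) {v : Fin d → ℝ} (hv : v ∈ P.extremePoints ℝ) (hPv : P ≠ {v}) :
    ∑ F ∈ (fcs P hP).filter (fun F => v ∈ F), sgn F = 0 := by
  obtain ⟨l, u, h1, h2⟩ := vertex_sep hP hv
  have hPc := IsPolytope.convex hP
  have hother : ∀ F, IsExposed ℝ P F → v ∈ F → F ≠ {v} → ∃ e ∈ F, l e < u := by
    intro F hF hvF hne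
    by_contra hcon
    push Not at hcon
    refine hne (eq_singleton_of_ext hP hF hvF ?_)
    rintro e ⟨heF, he⟩
    by_contra h
    exact absurd (h1 e (subset_convexHull ℝ _ ⟨he, h⟩)) (not_lt.2 (hcon e heF))
  have key := euler_lin (Finset.insertNone (fcs P hP)) (fun o => o.elim (-1) fun _ => 1)
    (fun o => o.elim 1 fun F => if v ∈ F ∧ F ≠ {v} then - sgn F else 0)
    (fun o => (o.elim P fun F => cell P F) ∩ {x | l x = u}) ?_ ?_
  · rw [Finset.sum_insertNone] at key
    simp only [Option.elim, one_mul] at key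
    rw [← Finset.sum_filter, Finset.sum_neg_distrib] at key
    have hmem : {v} ∈ (fcs P hP).filter (fun F => v ∈ F) := by
      simp [mem_fcs, vertex_exposed hP hv]
    rw [← Finset.add_sum_erase _ _ hmem, sgn_singleton]
    have : ((fcs P hP).filter (fun F => v ∈ F)).erase {v} =
        (fcs P hP).filter (fun F => v ∈ F ∧ F ≠ {v}) := by
      ext F
      simp only [Finset.mem_erase, Finset.mem_filter]
      tauto
    rw [this]
    linarith
  · intro o ho
    cases o with
    | none =>
      obtain ⟨e, he, hlt⟩ := hother P (IsExposed.refl P) hv.1 hPv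
      obtain ⟨x, hx, hx'⟩ := cell_slice_nonempty hP (IsExposed.refl P) l hv.1 he hlt h2
      exact Or.inr (Or.inl ⟨⟨x, hx.1, hx'⟩, isCompact_slice (IsPolytope.compact hP) l u,
        convex_slice hPc l u, rfl⟩)
    | some F =>
      have hF := (mem_fcs hP).1 (Finset.some_mem_insertNone.1 ho)
      simp only [Option.elim]
      by_cases h : v ∈ F ∧ F ≠ {v}
      · rw [if_pos h]
        obtain ⟨hvF, hne⟩ := h
        obtain ⟨e, he, hlt⟩ := hother F hF hvF hne
        refine Or.inr (Or.inr ⟨cell_slice_nonempty hP hF l hvF he hlt h2,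
          (IsPolytope.compact hP).isBounded.subset fun _ hx => hF.subset hx.1.1,
          convex_slice (cell_convex hF hPc) l u, _, (cell_relOpen hP hF).slice l u, ?_⟩)
        have hfr := finrank_inf_ker (vectorSpan ℝ F) l (v := v - e)
          (vsub_mem_vectorSpan ℝ hvF he) (by rw [map_sub]; exact ne_of_gt (by linarith))
        have hFe : F ≠ ∅ := Set.Nonempty.ne_empty ⟨v, hvF⟩
        rw [sgn, if_neg hFe, ← hfr, pow_succ]
        ring
      · rw [if_neg h]
        refine Or.inl ⟨?_, rfl⟩
        rw [Set.eq_empty_iff_forall_notMem]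
        rintro x ⟨hx, hxu⟩
        have hxu' : l x = u := hxu
        by_cases hvF : v ∈ F
        · have hFv : F = {v} := by
            by_contra hne
            exact h ⟨hvF, hne⟩
          have hxF := hx.1
          rw [hFv] at hxF
          rw [Set.mem_singleton_iff.1 hxF] at hxu'
          linarith
        · have hxF := hx.1
          rw [← face_hull hP hF] at hxF
          have := h1 x (convexHull_mono
            (show F ∩ P.extremePoints ℝ ⊆ P.extremePoints ℝ \ {v} from fun e he =>
              ⟨he.2, fun hev => hvF (by rw [← Set.mem_singleton_iff.1 hev]; exact he.1)⟩) hxF)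
          linarith
  · intro x
    rw [Finset.sum_insertNone]
    by_cases hx : l x = u
    · refine Eq.trans (b := (-1) * (if x ∈ P then (1 : ℤ) else 0) +
        ∑ F ∈ fcs P hP, if x ∈ cell P F then (1 : ℤ) else 0) ?_ (by rw [cell_cover]; ring)
      refine congrArg₂ _ ?_ (Finset.sum_congr rfl fun F _ => ?_)
      · simp [hx]
      · simp [hx]
    · simp [hx]

end vertex

lemma pdim_eq (F : Set (Fin d → ℝ)) :
    pdim F = if F = ∅ then -1 else (finrank ℝ (vectorSpan ℝ F) : ℤ) := by
  rw [pdim, direction_affineSpan]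

lemma pdim_ge (F : Set (Fin d → ℝ)) : -1 ≤ pdim F := by
  rw [pdim_eq]; split_ifs <;> omega

lemma pdim_nonneg {F : Set (Fin d → ℝ)} (h : F ≠ ∅) : 0 ≤ pdim F := by
  rw [pdim_eq, if_neg h]; omega

lemma sgn_eq (F : Set (Fin d → ℝ)) : sgn F = -(-1) ^ (pdim F + 1).toNat := by
  rw [sgn, pdim_eq]
  split_ifs with h
  · simp
  · have : ((finrank ℝ (vectorSpan ℝ F) : ℤ) + 1).toNat = finrank ℝ (vectorSpan ℝ F) + 1 := by omega
    rw [this, pow_succ]; ring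

lemma sgn_sq (F : Set (Fin d → ℝ)) : sgn F * sgn F = 1 := by
  rw [sgn_eq, neg_mul_neg, ← pow_add, ← two_mul, pow_mul]; simp

lemma pdim_lt {P F : Set (Fin d → ℝ)} (hF : IsExposed ℝ P F) (hne : F ≠ P) : pdim F < pdim P := by
  have hP : P ≠ ∅ := by
    rintro rfl
    exact hne (Set.subset_empty_iff.1 hF.subset)
  rcases F.eq_empty_or_nonempty with rfl | hFne
  · have := pdim_nonneg hP
    rw [pdim_eq ∅, if_pos rfl]; omega
  rw [pdim_eq, pdim_eq, if_neg hP, if_neg hFne.ne_empty]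
  obtain ⟨l, hl⟩ := hF hFne
  obtain ⟨x0, hx0⟩ := hFne
  have hx0' := hx0
  rw [hl] at hx0'
  obtain ⟨y, hy, hyF⟩ : ∃ y ∈ P, y ∉ F := by
    by_contra hcon
    push Not at hcon
    exact hne (Set.Subset.antisymm hF.subset hcon)
  have hylt : l y ≠ l x0 := by
    intro h
    apply hyF
    rw [hl]
    exact ⟨hy, fun z hz => h ▸ hx0'.2 z hz⟩
  have h1 : vectorSpan ℝ F ≤ LinearMap.ker l.toLinearMap := by
    rw [vectorSpan_eq_span_vsub_set_right ℝ hx0, Submodule.span_le]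
    rintro _ ⟨z, hz, rfl⟩
    rw [hl] at hz
    have : l z = l x0 := le_antisymm (hx0'.2 z hz.1) (hz.2 x0 hx0'.1)
    change l (z - x0) = 0
    rw [map_sub, this, sub_self]
  have h2 : vectorSpan ℝ F < vectorSpan ℝ P := by
    refine lt_of_le_of_ne (vectorSpan_mono ℝ hF.subset) fun h => ?_
    have h3 : y - x0 ∈ vectorSpan ℝ P := vsub_mem_vectorSpan ℝ hy hx0'.1
    rw [← h] at h3
    have h4 : l (y - x0) = 0 := h1 h3
    rw [map_sub] at h4
    exact hylt (sub_eq_zero.1 h4)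
  exact_mod_cast Submodule.finrank_lt_finrank_of_lt h2

lemma sign_pow {P F : Set (Fin d → ℝ)} (h : pdim F < pdim P) :
    ((-1 : ℤ)) ^ (pdim P - pdim F - 1).toNat = -(sgn P * sgn F) := by
  rw [sgn_eq, sgn_eq, neg_mul_neg, ← pow_add]
  have := pdim_ge F
  have e : (pdim P + 1).toNat + (pdim F + 1).toNat =
      2 * (pdim F + 1).toNat + 1 + (pdim P - pdim F - 1).toNat := by omega
  rw [e, pow_add, pow_add, pow_mul]
  simp

lemma coeff_pow (k : ℕ) : ((X - 1 : ℤ[X]) ^ k).coeff 0 = (-1) ^ k ∧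
    ((X - 1 : ℤ[X]) ^ k).coeff 1 = -((-1) ^ k * k) := by
  induction k with
  | zero => simp [coeff_one]
  | succ k ih =>
    rw [pow_succ, mul_coeff_zero, mul_coeff_one, ih.1, ih.2]
    simp [coeff_one, coeff_X, pow_succ]
    ring

end GSimplex

namespace GSimplex

open Filter Topology Module

variable {d : ℕ}

lemma h_eq {g h : Set (Fin d → ℝ) → Polynomial ℤ} (hGH : IsGH g h) {P : Set (Fin d → ℝ)}
    (hP : IsPolytope P) :
    h P = ∑ F ∈ (fcs P hP).erase P, (X - 1 : ℤ[X]) ^ (pdim P - pdim F - 1).toNat * g F := by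
  rw [hGH.2.1 P hP, ← finsum_mem_coe_finset]
  have : {F : Set (Fin d → ℝ) | IsFace P F ∧ F ≠ P} = ((fcs P hP).erase P : Finset _) := by
    ext F
    simp [mem_fcs, isFace_iff]
  rw [this]

/-- Number of vertices. -/
def f0 (P : Set (Fin d → ℝ)) : ℤ := ((P.extremePoints ℝ).ncard : ℤ)

lemma f0_face {P : Set (Fin d → ℝ)} (hP : IsPolytope P) {F : Set (Fin d → ℝ)}
    (hF : IsExposed ℝ P F) :
    f0 F = ∑ v ∈ (IsPolytope.finite_ext hP).toFinset, if v ∈ F then (1 : ℤ) else 0 := by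
  rw [f0, face_ext hF, Finset.sum_boole]
  rw [← Set.ncard_coe_finset]
  congr 2
  ext v
  simp [and_comm]

lemma sum_sgn {P : Set (Fin d → ℝ)} (hP : IsPolytope P) (hne : P.Nonempty) :
    ∑ F ∈ (fcs P hP).erase P, (-(sgn P * sgn F)) = 1 := by
  have h1 := euler1 hP hne
  have h2 : P ∈ fcs P hP := (mem_fcs hP).2 (IsExposed.refl P)
  rw [← Finset.add_sum_erase _ _ h2] at h1
  rw [Finset.sum_neg_distrib, ← Finset.mul_sum]
  have h3 : ∑ F ∈ (fcs P hP).erase P, sgn F = - sgn P := by linarith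
  rw [h3]
  linarith [sgn_sq P]

lemma sum_sgn_vertex {P : Set (Fin d → ℝ)} (hP : IsPolytope P) {v : Fin d → ℝ}
    (hv : v ∈ P.extremePoints ℝ) (hPv : P ≠ {v}) :
    ∑ F ∈ (fcs P hP).erase P, (-(sgn P * sgn F)) * (if v ∈ F then (1 : ℤ) else 0) = 1 := by
  have h1 := euler2 hP hv hPv
  have h2 : P ∈ fcs P hP := (mem_fcs hP).2 (IsExposed.refl P)
  rw [Finset.sum_filter, ← Finset.add_sum_erase _ _ h2, if_pos hv.1] at h1
  have h3 : ∑ F ∈ (fcs P hP).erase P, (if v ∈ F then sgn F else 0) = - sgn P := by linarith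
  have h4 : ∀ F ∈ (fcs P hP).erase P, (-(sgn P * sgn F)) * (if v ∈ F then (1 : ℤ) else 0) =
      -sgn P * (if v ∈ F then sgn F else 0) := by
    intro F _
    split_ifs <;> ring
  rw [Finset.sum_congr rfl h4, ← Finset.mul_sum, h3]
  linarith [sgn_sq P]

lemma sum_f0 {P : Set (Fin d → ℝ)} (hP : IsPolytope P) (hd : 1 ≤ pdim P) :
    ∑ F ∈ (fcs P hP).erase P, (-(sgn P * sgn F)) * f0 F = f0 P := by
  have h1 : ∀ F ∈ (fcs P hP).erase P, (-(sgn P * sgn F)) * f0 F =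
      ∑ v ∈ (IsPolytope.finite_ext hP).toFinset,
        (-(sgn P * sgn F)) * (if v ∈ F then (1 : ℤ) else 0) := by
    intro F hF
    rw [f0_face hP ((mem_fcs hP).1 (Finset.mem_of_mem_erase hF)), Finset.mul_sum]
  rw [Finset.sum_congr rfl h1, Finset.sum_comm]
  have h2 : ∀ v ∈ (IsPolytope.finite_ext hP).toFinset,
      ∑ F ∈ (fcs P hP).erase P, (-(sgn P * sgn F)) * (if v ∈ F then (1 : ℤ) else 0) = 1 := by
    intro v hv
    refine sum_sgn_vertex hP (by simpa using hv) ?_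
    rintro rfl
    rw [pdim_eq, if_neg (Set.singleton_ne_empty v), vectorSpan_singleton, finrank_bot] at hd
    simp at hd
  rw [Finset.sum_congr rfl h2, f0]
  rw [Finset.sum_const, Set.ncard_eq_toFinset_card _ (IsPolytope.finite_ext hP)]
  simp

lemma h_coeffs {g h : Set (Fin d → ℝ) → Polynomial ℤ} (hGH : IsGH g h) {P : Set (Fin d → ℝ)}
    (hP : IsPolytope P) (hne : P.Nonempty)
    (IH : ∀ F, IsExposed ℝ P F → F ≠ P →
      (g F).coeff 0 = 1 ∧ (g F).coeff 1 = f0 F - pdim F - 1) :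
    (h P).coeff 0 = 1 ∧ (1 ≤ pdim P → (h P).coeff 1 = f0 P - pdim P) := by
  rw [h_eq hGH hP]
  simp only [finsetSum_coeff]
  constructor
  · refine Eq.trans (Finset.sum_congr rfl fun F hF => ?_) (sum_sgn hP hne)
    rw [Finset.mem_erase, mem_fcs] at hF
    rw [mul_coeff_zero, (coeff_pow _).1, (IH F hF.2 hF.1).1, sign_pow (pdim_lt hF.2 hF.1), mul_one]
  · intro hd
    have : f0 P - pdim P = ∑ F ∈ (fcs P hP).erase P,
        ((-(sgn P * sgn F)) * f0 F - (-(sgn P * sgn F)) * pdim P) := by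
      rw [Finset.sum_sub_distrib, ← Finset.sum_mul, sum_sgn hP hne, sum_f0 hP hd, one_mul]
    rw [this]
    refine Finset.sum_congr rfl fun F hF => ?_
    rw [Finset.mem_erase, mem_fcs] at hF
    have hlt := pdim_lt hF.2 hF.1
    rw [mul_coeff_one, (coeff_pow _).1, (coeff_pow _).2, (IH F hF.2 hF.1).1, (IH F hF.2 hF.1).2,
      sign_pow hlt]
    have : (((pdim P - pdim F - 1).toNat : ℕ) : ℤ) = pdim P - pdim F - 1 := by omega
    rw [this]
    ring

lemma pdim_empty : pdim (∅ : Set (Fin d → ℝ)) = -1 := by rw [pdim, if_pos rfl]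

lemma pdim_zero {P : Set (Fin d → ℝ)} (h : pdim P = 0) : ∃ p, P = {p} := by
  have hne : P ≠ ∅ := by
    rintro rfl
    rw [pdim_empty] at h
    omega
  rw [pdim_eq, if_neg hne] at h
  have h1 : vectorSpan ℝ P = ⊥ := Submodule.finrank_eq_zero.1 (by exact_mod_cast h)
  obtain ⟨p, hp⟩ := Set.nonempty_iff_ne_empty.2 hne
  have := (vectorSpan_eq_bot_iff_subsingleton ℝ).1 h1
  exact ⟨p, this.eq_singleton_of_mem hp⟩

theorem g_coeffs {g h : Set (Fin d → ℝ) → Polynomial ℤ} (hGH : IsGH g h) :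
    ∀ (n : ℕ) (P : Set (Fin d → ℝ)), IsPolytope P → (pdim P + 1).toNat = n →
      (g P).coeff 0 = 1 ∧ (g P).coeff 1 = f0 P - pdim P - 1 := by
  intro n
  induction n using Nat.strong_induction_on with
  | _ n ih =>
    intro P hP hn
    rcases P.eq_empty_or_nonempty with rfl | hne
    · rw [hGH.1, pdim_empty]
      simp [f0, coeff_one]
    have hd0 := pdim_nonneg hne.ne_empty
    have IH : ∀ F, IsExposed ℝ P F → F ≠ P →
        (g F).coeff 0 = 1 ∧ (g F).coeff 1 = f0 F - pdim F - 1 := by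
      intro F hF hFP
      have h1 := pdim_lt hF hFP
      have h2 := pdim_ge F
      exact ih (pdim F + 1).toNat (by omega) F (face_polytope hP hF) rfl
    obtain ⟨a, b, c⟩ := hGH.2.2 P hP hne.ne_empty
    obtain ⟨h0, h1⟩ := h_coeffs hGH hP hne IH
    refine ⟨a.trans h0, ?_⟩
    by_cases hd2 : 2 ≤ pdim P
    · rw [b 1 one_pos (by omega), h1 (by omega), Nat.sub_self, h0]
    · rw [c 1 one_pos (by omega)]
      by_cases hd1 : pdim P = 1
      · have h2 := h1 hd1.ge
        have h3 : (h P).coeff 1 = 1 := by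
          have hem : ∅ ∈ (fcs P hP).erase P := by
            rw [Finset.mem_erase, mem_fcs]
            exact ⟨hne.ne_empty.symm, isExposed_empty⟩
          rw [h_eq hGH hP, finsetSum_coeff, Finset.sum_eq_single_of_mem _ hem]
          · rw [hd1, pdim_empty, hGH.1, mul_one, (coeff_pow _).2]
            simp
          · intro F hF hFe
            rw [Finset.mem_erase, mem_fcs] at hF
            have hlt := pdim_lt hF.2 hF.1
            have h5 := pdim_nonneg hFe
            have h6 : (pdim P - pdim F - 1).toNat = 0 := by omega
            rw [h6, pow_zero, one_mul]
            exact (hGH.2.2 F (face_polytope hP hF.2) hFe).2.2 1 one_pos (by omega)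
        omega
      · have hd : pdim P = 0 := by omega
        obtain ⟨p, rfl⟩ := pdim_zero hd
        rw [hd, f0, extremePoints_singleton, Set.ncard_singleton]
        simp

/-- If `g P = 1` then `P` is a simplex. -/
theorem simplex_of_g {g h : Set (Fin d → ℝ) → Polynomial ℤ} (hGH : IsGH g h)
    {P : Set (Fin d → ℝ)} (hP : IsPolytope P) (hfull : affineSpan ℝ P = ⊤) (hg : g P = 1) :
    ∃ s : Finset (Fin d → ℝ), s.card = d + 1 ∧
      AffineIndependent ℝ (fun x : ↥(s : Set (Fin d → ℝ)) => (x : Fin d → ℝ)) ∧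
      P = convexHull ℝ (s : Set (Fin d → ℝ)) := by
  have hne : P ≠ ∅ := by
    rintro rfl
    rw [AffineSubspace.span_empty] at hfull
    exact bot_ne_top hfull
  have hdim : pdim P = d := by
    rw [pdim, if_neg hne, hfull, AffineSubspace.direction_top, finrank_top]
    simp
  have h1 := (g_coeffs hGH _ P hP rfl).2
  rw [hg, hdim, coeff_one] at h1
  have hfin := IsPolytope.finite_ext hP
  have hcard : hfin.toFinset.card = d + 1 := by
    rw [f0, Set.ncard_eq_toFinset_card _ hfin] at h1
    simp at h1
    omega
  refine ⟨hfin.toFinset, hcard, ?_, ?_⟩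
  · rw [affineIndependent_iff_finrank_vectorSpan_eq ℝ _ (n := d)]
    · have : Set.range (fun x : ↥(hfin.toFinset : Set (Fin d → ℝ)) => (x : Fin d → ℝ)) =
        P.extremePoints ℝ := by simp
      rw [this, ← direction_affineSpan, ← affineSpan_convexHull, IsPolytope.hull hP, hfull,
        AffineSubspace.direction_top, finrank_top]
      simp
    · simpa using hcard
  · rw [Set.Finite.coe_toFinset, IsPolytope.hull hP]

end GSimplex

namespace GSimplex

open Filter Topology Module

variable {d : ℕ}

/-- Barycentric functional of a subset of an affine basis. -/
lemma exists_functional {s : Finset (Fin d → ℝ)}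
    (hs : AffineIndependent ℝ (fun x : ↥(s : Set (Fin d → ℝ)) => (x : Fin d → ℝ)))
    (htop : affineSpan ℝ (s : Set (Fin d → ℝ)) = ⊤) (B : Finset (Fin d → ℝ)) :
    ∃ (f : (Fin d → ℝ) →ₗ[ℝ] ℝ) (c : ℝ), ∀ a ∈ s, f a = c - if a ∈ B then 0 else 1 := by
  let b : AffineBasis ↥(s : Set (Fin d → ℝ)) ℝ (Fin d → ℝ) :=
    ⟨fun x => x, hs, by simpa using htop⟩
  let t : Finset ↥(s : Set (Fin d → ℝ)) := Finset.univ.filter fun i => (i : Fin d → ℝ) ∈ B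
  have hF : ∀ a ∈ s, ∑ i ∈ t, b.coord i a = if a ∈ B then 1 else 0 := by
    intro a ha
    have hb : ∀ i, b.coord i a = if i = ⟨a, ha⟩ then 1 else 0 := fun i =>
      b.coord_apply i ⟨a, ha⟩
    simp only [hb]
    rw [Finset.sum_ite_eq']
    simp [t]
  refine ⟨∑ i ∈ t, (b.coord i).linear, 1 - ∑ i ∈ t, b.coord i 0, fun a ha => ?_⟩
  have h1 := hF a ha
  have h2 : ∀ i, b.coord i a = (b.coord i).linear a + b.coord i 0 := fun i =>
    congrFun (b.coord i).decomp a
  simp only [h2] at h1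
  rw [Finset.sum_add_distrib] at h1
  rw [LinearMap.sum_apply]
  split_ifs at h1 ⊢ <;> linarith

lemma functional_hull {A B : Finset (Fin d → ℝ)} (hBA : B ⊆ A) {f : (Fin d → ℝ) →ₗ[ℝ] ℝ} {c : ℝ}
    (hf : ∀ a ∈ A, f a = c - if a ∈ B then 0 else 1) :
    (∀ x ∈ convexHull ℝ (A : Set (Fin d → ℝ)), f x ≤ c) ∧
    convexHull ℝ (B : Set (Fin d → ℝ)) = {x ∈ convexHull ℝ (A : Set (Fin d → ℝ)) | f x = c} := by
  have key : ∀ w : (Fin d → ℝ) → ℝ, ∑ y ∈ A, w y = 1 →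
      f (∑ y ∈ A, w y • y) = c - ∑ y ∈ A, (if y ∈ B then 0 else w y) := by
    intro w hw
    have h1 : c = ∑ y ∈ A, w y * c := by rw [← Finset.sum_mul, hw, one_mul]
    rw [map_sum]
    conv_rhs => rw [h1]
    rw [← Finset.sum_sub_distrib]
    refine Finset.sum_congr rfl fun y hy => ?_
    rw [map_smul, smul_eq_mul, hf y hy]
    split_ifs <;> ring
  have hnn : ∀ w : (Fin d → ℝ) → ℝ, (∀ y ∈ A, 0 ≤ w y) →
      ∀ y ∈ A, 0 ≤ (if y ∈ B then 0 else w y) := by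
    intro w hw y hy
    split_ifs
    exacts [le_rfl, hw y hy]
  refine ⟨fun x hx => ?_, ?_⟩
  · obtain ⟨w, hw0, hw1, rfl⟩ := Finset.mem_convexHull'.1 hx
    rw [key w hw1]
    linarith [Finset.sum_nonneg (hnn w hw0)]
  · apply Set.Subset.antisymm
    · intro x hx
      refine ⟨convexHull_mono (by exact_mod_cast hBA) hx, ?_⟩
      have h2 : convexHull ℝ (B : Set (Fin d → ℝ)) ⊆ {y | f y = c} := by
        refine convexHull_min (fun y hy => ?_) (convex_hyperplane f.isLinear c)
        have := hf y (hBA hy)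
        rw [if_pos (by exact_mod_cast hy), sub_zero] at this
        exact this
      exact h2 hx
    · rintro x ⟨hx, hxc⟩
      obtain ⟨w, hw0, hw1, rfl⟩ := Finset.mem_convexHull'.1 hx
      rw [key w hw1] at hxc
      have h3 : ∑ y ∈ A, (if y ∈ B then 0 else w y) = 0 := by linarith
      have h4 := (Finset.sum_eq_zero_iff_of_nonneg (hnn w hw0)).1 h3
      have h5 : ∀ y ∈ A, y ∉ B → w y = 0 := fun y hy hyB => by
        have := h4 y hy
        rwa [if_neg hyB] at this
      rw [Finset.mem_convexHull']
      refine ⟨w, fun y hy => hw0 y (hBA hy), ?_, ?_⟩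
      · rw [← hw1]
        exact Finset.sum_subset hBA h5
      · exact Finset.sum_subset hBA fun y hy hyB => by rw [h5 y hy hyB, zero_smul]

lemma sum_ssubsets (A : Finset (Fin d → ℝ)) :
    ∑ B ∈ A.ssubsets, (X - 1 : ℤ[X]) ^ (A.card - B.card - 1) = ∑ i ∈ Finset.range A.card, X ^ i := by
  have hX : (X - 1 : ℤ[X]) ≠ 0 := X_sub_C_ne_zero (1 : ℤ)
  apply mul_right_cancel₀ hX
  rw [geom_sum_mul, Finset.sum_mul]
  have h1 := Finset.sum_pow_mul_eq_add_pow (1 : ℤ[X]) (X - 1) A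
  rw [add_sub_cancel, ← Finset.insert_erase (Finset.mem_powerset_self A),
    Finset.sum_insert (Finset.notMem_erase _ _)] at h1
  simp only [one_pow, one_mul, Nat.sub_self, pow_zero] at h1
  rw [← h1, add_sub_cancel_left]
  refine Finset.sum_congr rfl fun B hB => ?_
  have := Finset.card_lt_card (Finset.mem_ssubsets.1 hB)
  rw [← pow_succ]
  congr 1
  omega

lemma pdim_hull {A : Finset (Fin d → ℝ)}
    (hA : AffineIndependent ℝ (fun x : ↥(A : Set (Fin d → ℝ)) => (x : Fin d → ℝ))) :
    pdim (convexHull ℝ (A : Set (Fin d → ℝ))) = A.card - 1 := by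
  rcases A.eq_empty_or_nonempty with rfl | hne
  · simp [pdim_empty]
  · have h1 : convexHull ℝ (A : Set (Fin d → ℝ)) ≠ ∅ := by
      rw [Ne, convexHull_eq_empty]
      simpa using hne.ne_empty
    rw [pdim, if_neg h1, affineSpan_convexHull, direction_affineSpan]
    have h2 := hA.finrank_vectorSpan (n := A.card - 1) (by
      have := hne.card_pos
      simp
      omega)
    rw [Subtype.range_coe] at h2
    rw [h2]
    have := hne.card_pos
    omega

theorem g_of_simplex {g h : Set (Fin d → ℝ) → Polynomial ℤ} (hGH : IsGH g h)
    {s : Finset (Fin d → ℝ)}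
    (hs : AffineIndependent ℝ (fun x : ↥(s : Set (Fin d → ℝ)) => (x : Fin d → ℝ)))
    (htop : affineSpan ℝ (s : Set (Fin d → ℝ)) = ⊤) (A : Finset (Fin d → ℝ)) :
    A ⊆ s → g (convexHull ℝ (A : Set (Fin d → ℝ))) = 1 := by
  induction A using Finset.strongInduction with
  | _ A ih =>
    intro hAs
    rcases A.eq_empty_or_nonempty with rfl | hne
    · simpa using hGH.1
    have hP : IsPolytope (convexHull ℝ (A : Set (Fin d → ℝ))) := ⟨A, rfl⟩
    have hPne : convexHull ℝ (A : Set (Fin d → ℝ)) ≠ ∅ := by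
      rw [Ne, convexHull_eq_empty]
      simpa using hne.ne_empty
    have hdim : ∀ B, B ⊆ A → pdim (convexHull ℝ (B : Set (Fin d → ℝ))) = B.card - 1 :=
      fun B hB => pdim_hull (hs.mono (by exact_mod_cast hB.trans hAs))
    have hface : ∀ B, B ⊆ A → IsExposed ℝ (convexHull ℝ (A : Set (Fin d → ℝ)))
        (convexHull ℝ (B : Set (Fin d → ℝ))) := by
      intro B hB
      obtain ⟨f, c, hf⟩ := exists_functional hs htop B
      have := functional_hull hB (fun a ha => hf a (hAs ha))
      exact isFace_iff.1 (Or.inr (Or.inr ⟨f, c, this.1, this.2⟩))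
    have hinj : ∀ B C, B ⊆ A → C ⊆ A → convexHull ℝ (B : Set (Fin d → ℝ)) ⊆
        convexHull ℝ (C : Set (Fin d → ℝ)) → B ⊆ C := by
      intro B C hB hC hBC x hx
      obtain ⟨f, c, hf⟩ := exists_functional hs htop C
      have h1 := functional_hull hC (fun a ha => hf a (hAs ha))
      have h2 := hBC (subset_convexHull ℝ _ (Finset.mem_coe.2 hx))
      rw [h1.2] at h2
      have h3 := hf x (hAs (hB hx))
      by_contra hxC
      rw [if_neg hxC, h2.2] at h3
      linarith
    have hh : h (convexHull ℝ (A : Set (Fin d → ℝ))) = ∑ i ∈ Finset.range A.card, X ^ i := by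
      rw [h_eq hGH hP, ← sum_ssubsets]
      symm
      refine Finset.sum_bij (fun B _ => convexHull ℝ (B : Set (Fin d → ℝ))) ?_ ?_ ?_ ?_
      · intro B hB
        rw [Finset.mem_ssubsets] at hB
        rw [Finset.mem_erase, mem_fcs]
        refine ⟨fun h => hB.2 (hinj A B subset_rfl hB.1 h.ge), hface B hB.1⟩
      · intro B hB C hC hBC
        rw [Finset.mem_ssubsets] at hB hC
        exact (hinj B C hB.1 hC.1 hBC.le).antisymm (hinj C B hC.1 hB.1 hBC.ge)
      · intro F hF
        rw [Finset.mem_erase, mem_fcs] at hF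
        have h1 := face_hull hP hF.2
        have h2 : F ∩ (convexHull ℝ (A : Set (Fin d → ℝ))).extremePoints ℝ ⊆ A :=
          Set.inter_subset_right.trans extremePoints_convexHull_subset
        obtain ⟨B, hB⟩ := (A.finite_toSet.subset h2).exists_finset_coe
        rw [← hB] at h1 h2
        refine ⟨B, ?_, h1⟩
        rw [Finset.mem_ssubsets]
        refine lt_of_le_of_ne (by exact_mod_cast h2) ?_
        rintro rfl
        exact hF.1 h1.symm
      · intro B hB
        rw [Finset.mem_ssubsets] at hB
        rw [ih B hB (hB.1.trans hAs), mul_one, hdim A subset_rfl, hdim B hB.1]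
        congr 1
        have := Finset.card_lt_card hB
        omega
    have hco : ∀ i, (h (convexHull ℝ (A : Set (Fin d → ℝ)))).coeff i = if i < A.card then 1 else 0 := by
      intro i
      rw [hh, finsetSum_coeff]
      simp [coeff_X_pow]
    obtain ⟨a, b, c⟩ := hGH.2.2 _ hP hPne
    have hcard := hne.card_pos
    ext i
    rw [coeff_one]
    rcases Nat.eq_zero_or_pos i with rfl | hi
    · rw [a, hco, if_pos hcard, if_pos rfl]
    · rw [if_neg (by omega)]
      by_cases h2 : 2 * (i : ℤ) ≤ pdim (convexHull ℝ (A : Set (Fin d → ℝ)))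
      · rw [b i hi h2, hco, hco]
        rw [hdim A subset_rfl] at h2
        rw [if_pos (by omega), if_pos (by omega), sub_self]
      · exact c i hi h2

end GSimplex

/-- For a `d`-dimensional convex polytope `P ⊆ ℝ^d`, `g(P) = 1`
if and only if `P` is a simplex (the convex hull of `d+1` affinely independent
points). -/
theorem g_eq_one_iff_simplex {d : ℕ} (g h : Set (Fin d → ℝ) → Polynomial ℤ)
    (hGH : IsGH g h) (P : Set (Fin d → ℝ)) (hP : IsPolytope P)
    (hfull : affineSpan ℝ P = ⊤) :
    g P = 1 ↔ ∃ s : Finset (Fin d → ℝ), s.card = d + 1 ∧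
      AffineIndependent ℝ (fun x : ↥(s : Set (Fin d → ℝ)) => (x : Fin d → ℝ)) ∧
      P = convexHull ℝ (s : Set (Fin d → ℝ)) := by
  constructor
  · exact GSimplex.simplex_of_g hGH hP hfull
  · rintro ⟨s, -, hs, rfl⟩
    rw [affineSpan_convexHull] at hfull
    exact GSimplex.g_of_simplex hGH hs hfull s subset_rfl

end
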